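/- There is no function θ ∈ C³([−L,L]) (L > 0) such that θ(x) > 0 for all x ∈ (−L,L), θ(−L) = θ(L) = 0, and θ satisfies the third-order nonlinear dispersion profile equation (1/3)·θ(x) = θ(x)³·(θ‴(x) + θ(x)) for all x ∈ (−L,L). -/

import Mathlib

/-- Nonexistence of positive separable blow-up profiles for the nonlinear
dispersion equation `u_t = u³(u_xxx + u)`: there is no `θ ∈ C³([−L,L])` with
`θ > 0` on `(−L,L)`, `θ(±L) = 0`, satisfying `(1/3)θ = θ³(θ‴ + θ)` on `(−L,L)`. -/
theorem no_third_order_dispersion_profile_interval (L : ℝ) (hL : 0 < L) :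
    ¬ ∃ θ : ℝ → ℝ,
      ContDiffOn ℝ 3 θ (Set.Icc (-L) L) ∧
      (∀ x ∈ Set.Ioo (-L) L, 0 < θ x) ∧
      θ (-L) = 0 ∧ θ L = 0 ∧
      (∀ x ∈ Set.Ioo (-L) L,
        (1/3 : ℝ) * θ x
          = (θ x)^3 * (iteratedDerivWithin 3 θ (Set.Icc (-L) L) x + θ x)) := by
  rintro ⟨θ, hθ, hpos, hleft, -, hode⟩
  have hlt : -L < L := by linarith
  have hcont : ContinuousOn
      (fun x => θ x ^ 2 * (iteratedDerivWithin 3 θ (Set.Icc (-L) L) x + θ x))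
      (Set.Icc (-L) L) :=
    (hθ.continuousOn.pow 2).mul
      ((hθ.continuousOn_iteratedDerivWithin le_rfl (uniqueDiffOn_Icc hlt)).add hθ.continuousOn)
  -- Dividing the equation by `θ > 0` gives `θ² (θ‴ + θ) = 1/3` inside the interval.
  have hinterior : Set.EqOn
      (fun x => θ x ^ 2 * (iteratedDerivWithin 3 θ (Set.Icc (-L) L) x + θ x))
      (fun _ => 1 / 3) (Set.Ioo (-L) L) := by
    intro x hx
    apply mul_left_cancel₀ (hpos x hx).ne'
    linear_combination -hode x hx
  -- By continuity the identity persists at `-L`, where its left-hand side vanishes.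
  have hboundary := hinterior.of_subset_closure hcont continuousOn_const
    Set.Ioo_subset_Icc_self (closure_Ioo hlt.ne).ge (Set.left_mem_Icc.2 hlt.le)
  norm_num [hleft] at hboundary
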